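/- arXiv:1803.09931 — 2 statements merged into one kernel-verified Lean document; each statement's English description precedes it below -/
import Mathlib

section
/- Let n ≥ 1, N ≥ 1, θ ∈ ℂ, ω = exp(2πi/N), and let G be an n×n complex matrix with G^N = 1_n. Define k(λ) = θ·1_n + λ·G, τ(ν) = ων and g^{(j)}(ν) = ω^j for j = 0,…,N−1, and let r_{ab}(λ,μ) = P/(λ−μ) be the rational r-matrix. Then for all λ,ν ∈ ℂ such that λ ≠ ω^j ν for every j ∈ {0,…,N−1} and such that each matrix k(ω^j ν), j = 0,…,N−2, is invertible, k satisfies the N-reflection equation: ∑_{j=0}^{N−1} ω^j·k^{(j)}_b(ν)·(P/(λ−ω^j ν))·(k^{(j)}_b(ν))^{−1}·k_a(λ) = k_a(λ)·∑_{j=0}^{N−1} ω^j·k^{(j)}_b(ν)·(P/(ωλ−ω^j ν))·(k^{(j)}_b(ν))^{−1}. -/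
open Matrix Kronecker

noncomputable section

/-- `x_a = x ⊗ 1`, acting on `ℂ^n ⊗ ℂ^n`. -/
def legA (n : ℕ) (x : Matrix (Fin n) (Fin n) ℂ) :
    Matrix (Fin n × Fin n) (Fin n × Fin n) ℂ :=
  x ⊗ₖ (1 : Matrix (Fin n) (Fin n) ℂ)

/-- `x_b = 1 ⊗ x`, acting on `ℂ^n ⊗ ℂ^n`. -/
def legB (n : ℕ) (x : Matrix (Fin n) (Fin n) ℂ) :
    Matrix (Fin n × Fin n) (Fin n × Fin n) ℂ :=
  (1 : Matrix (Fin n) (Fin n) ℂ) ⊗ₖ x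

/-- The swap (permutation) matrix `P : P(u ⊗ v) = v ⊗ u`. -/
def Pmat (n : ℕ) : Matrix (Fin n × Fin n) (Fin n × Fin n) ℂ :=
  Matrix.of fun i j => if i.1 = j.2 ∧ i.2 = j.1 then 1 else 0

/-- `k⁽ʲ⁾(ν) = k⁽ʲ⁻¹⁾(ν) · k(τʲ⁻¹(ν))`, with `k⁽⁰⁾ = 1`. -/
def kiter {n : ℕ} (k : ℂ → Matrix (Fin n) (Fin n) ℂ) (τ : ℂ → ℂ) :
    ℕ → ℂ → Matrix (Fin n) (Fin n) ℂ
  | 0, _ => 1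
  | j + 1, ν => kiter k τ j ν * k (τ^[j] ν)

theorem key_sum {R : Type*} [Ring R] [Algebra ℂ R] (N : ℕ) (θ ω ν lam : ℂ) (A B : R) (T : ℕ → R)
    (h0 : T 0 = 1) (hNN : T N = 1)
    (hT : ∀ j < N, T (j+1) * (θ • (1:R) + (ω^j*ν) • B) = T j * (θ • (1:R) + (ω^j*ν) • A))
    (hz : ν = 0 → ∑ j ∈ Finset.range N, ω^j • (T j * A - T (j+1) * B) = 0)
    (hpole : ∀ j : ℕ, j < N → lam ≠ ω ^ j * ν) :
    (∑ j ∈ Finset.range N, (ω^j * (lam - ω^j*ν)⁻¹) • T j) * (θ • (1:R) + lam • A)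
    = (∑ j ∈ Finset.range N, (ω^j * (lam - ω^j*ν)⁻¹) • T (j+1)) * (θ • (1:R) + lam • B) := by
  have hS : ∑ j ∈ Finset.range N, ω^j • (T j * A - T (j+1) * B) = 0 := by
    by_cases hν : ν = 0
    · exact hz hν
    have h1 : ν • ∑ j ∈ Finset.range N, ω^j • (T j * A - T (j+1) * B) = 0 := by
      have h2 : ∑ j ∈ Finset.range N, θ • (T (j+1) - T j) = 0 := by
        rw [← Finset.smul_sum, Finset.sum_range_sub, h0, hNN, sub_self, smul_zero]
      rw [← h2, Finset.smul_sum]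
      refine Finset.sum_congr rfl fun j hj => ?_
      have := hT j (Finset.mem_range.mp hj)
      simp only [mul_add, mul_smul_comm, mul_one] at this
      rw [smul_smul, mul_comm ν, smul_sub, smul_sub, sub_eq_sub_iff_add_eq_add, add_comm, ← this,
        add_comm]
    exact (smul_eq_zero.mp h1).resolve_left hν
  rw [← sub_eq_zero, ← hS, Finset.sum_mul, Finset.sum_mul, ← Finset.sum_sub_distrib]
  refine Finset.sum_congr rfl fun j hj => ?_
  have hj := Finset.mem_range.mp hj
  have hd : lam - ω^j*ν ≠ 0 := sub_ne_zero.mpr (hpole j hj)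
  have e : ∀ C : R, θ • (1:R) + lam • C = (θ • (1:R) + (ω^j*ν) • C) + (lam - ω^j*ν) • C := by
    intro C; module
  have hTj := hT j hj
  rw [e A, e B]
  generalize θ • (1:R) + (ω^j*ν) • A = X at *
  generalize θ • (1:R) + (ω^j*ν) • B = Y at *
  simp only [mul_add, smul_mul_assoc, mul_smul_comm, smul_smul, smul_sub, smul_add, hTj]
  have e3 : (lam - ω^j*ν) * (ω^j * (lam - ω^j*ν)⁻¹) = ω^j := by field_simp
  have e4 : (ω^j * (lam - ω^j*ν)⁻¹) * (lam - ω^j*ν) = ω^j := by field_simp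
  simp only [e3, e4]
  abel

theorem scalar_prod (N : ℕ) (hN : 1 ≤ N) (θ ω ν : ℂ) (hω : IsPrimitiveRoot ω N) :
    ∏ j ∈ Finset.range N, (Polynomial.C θ + Polynomial.C (ω^j*ν) * Polynomial.X)
     = Polynomial.C (θ^N) - (Polynomial.C (-ν) * Polynomial.X)^N := by
  have hp : IsPrimitiveRoot (Polynomial.C ω) N := hω.map_of_injective Polynomial.C_injective
  rw [map_pow, hp.pow_sub_pow_eq_prod_sub_mul _ _ hN]
  symm
  haveI : NeZero N := ⟨by omega⟩
  refine Finset.prod_nbij' (s := Polynomial.nthRootsFinset N 1) (t := Finset.range N)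
    (fun z => if h : ∃ i < N, (Polynomial.C ω)^i = z then h.choose else 0)
    (fun j => (Polynomial.C ω)^j) ?_ ?_ ?_ ?_ ?_
  · intro z hz
    have h := hp.eq_pow_of_pow_eq_one ((Polynomial.mem_nthRootsFinset hN _).mp hz)
    simp only [h, dif_pos, Finset.mem_range]
    exact h.choose_spec.1
  · intro j hj
    rw [Polynomial.mem_nthRootsFinset hN, ← pow_mul, mul_comm, pow_mul, hp.pow_eq_one, one_pow]
  · intro z hz
    have h := hp.eq_pow_of_pow_eq_one ((Polynomial.mem_nthRootsFinset hN _).mp hz)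
    simp only [h, dif_pos]
    exact h.choose_spec.2
  · intro j hj
    have h : ∃ i < N, (Polynomial.C ω)^i = (Polynomial.C ω)^j := ⟨j, Finset.mem_range.mp hj, rfl⟩
    simp only [h, dif_pos]
    exact hp.pow_inj h.choose_spec.1 (Finset.mem_range.mp hj) h.choose_spec.2
  · intro z hz
    have h := hp.eq_pow_of_pow_eq_one ((Polynomial.mem_nthRootsFinset hN _).mp hz)
    simp only [h, dif_pos]
    conv_lhs => rw [← h.choose_spec.2]
    simp only [map_mul, map_pow, map_neg]
    ring

theorem iter_mul (ω ν : ℂ) (j : ℕ) : (fun x => ω * x)^[j] ν = ω^j * ν := by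
  induction j with
  | zero => simp
  | succ j ih => rw [Function.iterate_succ_apply', ih, pow_succ]; ring

theorem kiter_aeval {n : ℕ} (θ ω ν : ℂ) (G : Matrix (Fin n) (Fin n) ℂ)
    (k : ℂ → Matrix (Fin n) (Fin n) ℂ)
    (hk : ∀ x : ℂ, k x = θ • (1 : Matrix (Fin n) (Fin n) ℂ) + x • G) (j : ℕ) :
    kiter k (fun x => ω * x) j ν = Polynomial.aeval G
      (∏ i ∈ Finset.range j, (Polynomial.C θ + Polynomial.C (ω^i*ν) * Polynomial.X)) := by
  induction j with
  | zero => simp [kiter]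
  | succ j ih =>
    rw [kiter, ih, Finset.prod_range_succ, map_mul, iter_mul, hk]
    simp only [map_add, map_mul (Polynomial.aeval G), Polynomial.aeval_C, Polynomial.aeval_X,
      Algebra.algebraMap_eq_smul_one, smul_mul_assoc, one_mul]

theorem legA_mul (n : ℕ) (x y : Matrix (Fin n) (Fin n) ℂ) : legA n (x * y) = legA n x * legA n y := by
  simp [legA, ← Matrix.mul_kronecker_mul]

theorem legB_mul (n : ℕ) (x y : Matrix (Fin n) (Fin n) ℂ) : legB n (x * y) = legB n x * legB n y := by
  simp [legB, ← Matrix.mul_kronecker_mul]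

theorem legAB (n : ℕ) (x y : Matrix (Fin n) (Fin n) ℂ) : Commute (legA n x) (legB n y) := by
  simp [Commute, SemiconjBy, legA, legB, ← Matrix.mul_kronecker_mul]

theorem legA_P (n : ℕ) (x : Matrix (Fin n) (Fin n) ℂ) : legA n x * Pmat n = Pmat n * legB n x := by
  ext ⟨a, b⟩ ⟨c, d⟩
  simp [legA, legB, Pmat, Matrix.mul_apply, Fintype.sum_prod_type, Matrix.one_apply, ite_and]

theorem legB_P (n : ℕ) (x : Matrix (Fin n) (Fin n) ℂ) : legB n x * Pmat n = Pmat n * legA n x := by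
  ext ⟨a, b⟩ ⟨c, d⟩
  simp [legA, legB, Pmat, Matrix.mul_apply, Fintype.sum_prod_type, Matrix.one_apply, ite_and]

theorem legA_k (n : ℕ) (θ x : ℂ) (G : Matrix (Fin n) (Fin n) ℂ) :
    legA n (θ • 1 + x • G) = θ • 1 + x • legA n G := by
  simp [legA, Matrix.add_kronecker, Matrix.smul_kronecker]

theorem legB_k (n : ℕ) (θ x : ℂ) (G : Matrix (Fin n) (Fin n) ℂ) :
    legB n (θ • 1 + x • G) = θ • 1 + x • legB n G := by
  simp [legB, Matrix.kronecker_add, Matrix.kronecker_smul]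

/-- For `Gᴺ = 1`, the matrix `k(λ) = θ·1 + λ·G` solves the `N`-reflection equation
for the rational `r`-matrix `r(λ,μ) = P/(λ-μ)`, with `τ(ν) = ων`, `g⁽ʲ⁾(ν) = ωʲ`,
`ω = exp(2πi/N)`. -/
theorem stmt6 (n N : ℕ) (hn : 1 ≤ n) (hN : 1 ≤ N) (θ : ℂ)
    (ω : ℂ) (hω : ω = Complex.exp (2 * Real.pi * Complex.I / N))
    (G : Matrix (Fin n) (Fin n) ℂ) (hG : G ^ N = 1)
    (k : ℂ → Matrix (Fin n) (Fin n) ℂ)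
    (hk : ∀ x : ℂ, k x = θ • (1 : Matrix (Fin n) (Fin n) ℂ) + x • G)
    (lam ν : ℂ)
    (hpole : ∀ j : ℕ, j < N → lam ≠ ω ^ j * ν)
    (hinv : ∀ j : ℕ, j + 2 ≤ N → IsUnit (k (ω ^ j * ν))) :
    (∑ j ∈ Finset.range N, (ω ^ j) •
        (legB n (kiter k (fun x => ω * x) j ν) * ((lam - ω ^ j * ν)⁻¹ • Pmat n)
          * (legB n (kiter k (fun x => ω * x) j ν))⁻¹)) * legA n (k lam)
      = legA n (k lam) *
        ∑ j ∈ Finset.range N, (ω ^ j) •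
          (legB n (kiter k (fun x => ω * x) j ν) * ((ω * lam - ω ^ j * ν)⁻¹ • Pmat n)
            * (legB n (kiter k (fun x => ω * x) j ν))⁻¹) := by
  have hprim : IsPrimitiveRoot ω N := by
    rw [hω]; exact Complex.isPrimitiveRoot_exp N (by omega)
  have hω0 : ω ≠ 0 := hprim.ne_zero (by omega)
  set K : ℕ → Matrix (Fin n) (Fin n) ℂ := fun j => kiter k (fun x => ω * x) j ν with hK
  have hK0 : K 0 = 1 := rfl
  have hKs : ∀ j, K (j+1) = K j * k (ω^j*ν) := by
    intro j
    simp only [hK, kiter, iter_mul]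
  have hKp := kiter_aeval θ ω ν G k hk
  have hkp : ∀ x, k x = Polynomial.aeval G (Polynomial.C θ + Polynomial.C x * Polynomial.X) := by
    intro x
    rw [hk]; simp [Algebra.algebraMap_eq_smul_one]
  have hcomm : ∀ j x, Commute (K j) (k x) := by
    intro j x
    simp only [hK, hKp, hkp]
    rw [Commute, SemiconjBy, ← map_mul, ← map_mul, mul_comm]
  have hKN : K N = (θ^N - (-ν)^N) • 1 := by
    simp only [hK, hKp]
    rw [scalar_prod N hN θ ω ν hprim]
    simp only [mul_pow, map_sub, map_mul, map_pow, Polynomial.aeval_C, Polynomial.aeval_X, hG,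
      Algebra.algebraMap_eq_smul_one]
    simp only [smul_pow, one_pow, mul_one, sub_smul]
  have hKu : ∀ j, j < N → IsUnit (K j) := by
    intro j
    induction j with
    | zero => intro _; rw [hK0]; exact isUnit_one
    | succ j ih =>
      intro h
      rw [hKs]
      exact (ih (by omega)).mul (hinv j (by omega))
  set W : ℕ → Matrix (Fin n × Fin n) (Fin n × Fin n) ℂ := fun j => (legB n (K j))⁻¹ with hW
  have hVd : ∀ j, j < N → IsUnit (legB n (K j)).det := by
    intro j hj
    obtain ⟨y, hy⟩ := (hKu j hj).exists_right_inv
    refine Matrix.isUnit_det_of_right_inverse (B := legB n y) ?_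
    rw [← legB_mul, hy]; simp [legB]
  have hWV : ∀ j, j < N → W j * legB n (K j) = 1 := fun j hj => Matrix.nonsing_inv_mul _ (hVd j hj)
  have hVW : ∀ j, j < N → legB n (K j) * W j = 1 := fun j hj => Matrix.mul_nonsing_inv _ (hVd j hj)
  -- anything commuting with `V j` commutes with `W j`
  have hWc : ∀ j, j < N → ∀ X, Commute (legB n (K j)) X → Commute (W j) X := by
    intro j hj X hX
    have h1 : W j * X = W j * (X * legB n (K j)) * W j := by
      rw [mul_assoc, mul_assoc X, hVW j hj, mul_one]
    rw [Commute, SemiconjBy, h1, ← hX.eq, ← mul_assoc, hWV j hj, one_mul]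
  have hVk : ∀ j x, Commute (legB n (K j)) (legB n (k x)) := by
    intro j x
    rw [Commute, SemiconjBy, ← legB_mul, ← legB_mul, (hcomm j x).eq]
  have hWk : ∀ j, j < N → ∀ x, Commute (W j) (legB n (k x)) := fun j hj x =>
    hWc j hj _ (hVk j x)
  have hWa : ∀ j, j < N → ∀ x, Commute (W j) (legA n x) := fun j hj x =>
    hWc j hj _ (legAB n x _).symm
  set T : ℕ → Matrix (Fin n × Fin n) (Fin n × Fin n) ℂ :=
    fun j => if j < N then legA n (K j) * W j else 1 with hTdef
  have hTj : ∀ j, j < N → T j = legA n (K j) * W j := fun j hj => by simp [hTdef, hj]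
  have hTN : T N = 1 := by simp [hTdef]
  have hT0 : T 0 = 1 := by
    rw [hTj 0 (by omega)]
    have : W 0 = 1 := by simp [hW, hK0, legB]
    rw [this, hK0]; simp [legA]
  have hTrec : ∀ j < N, T (j+1) * legB n (k (ω^j*ν)) = T j * legA n (k (ω^j*ν)) := by
    intro j hj
    have hR : T j * legA n (k (ω^j*ν)) = legA n (K (j+1)) * W j := by
      rw [hTj j hj, mul_assoc, (hWa j hj _).eq, ← mul_assoc, ← legA_mul, ← hKs]
    rw [hR]
    rcases Nat.lt_or_ge (j+1) N with h | h
    · have h2 : W (j+1) * legB n (k (ω^j*ν)) = W j := by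
        have : W (j+1) * (legB n (K (j+1)) * W j) = W j := by
          rw [← mul_assoc, hWV _ h, one_mul]
        rw [hKs, (hcomm _ _).eq, legB_mul, mul_assoc, hVW j hj, mul_one] at this
        exact this
      rw [hTj _ h, mul_assoc, h2]
    · have h3 : j + 1 = N := by omega
      have h4 : legA n (K N) = legB n (K N) := by
        rw [hKN, legA, legB, Matrix.smul_kronecker, Matrix.kronecker_smul]
      rw [h3, hTN, one_mul, h4, ← h3, hKs, (hcomm _ _).eq, legB_mul, mul_assoc, hVW j hj, mul_one]
  have hrec' : ∀ j < N, T (j+1) * (θ • 1 + (ω^j*ν) • legB n G)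
      = T j * (θ • 1 + (ω^j*ν) • legA n G) := by
    intro j hj
    have := hTrec j hj
    rwa [hk, legA_k, legB_k] at this
  have hz : ν = 0 → ∑ j ∈ Finset.range N, ω^j • (T j * legA n G - T (j+1) * legB n G) = 0 := by
    intro hν
    rcases Nat.lt_or_ge 1 N with h1 | h1
    · have hθ : θ ≠ 0 := by
        intro h0
        have hu := hinv 0 (by omega)
        rw [hk, hν, h0] at hu
        haveI : Nonempty (Fin n) := ⟨⟨0, by omega⟩⟩
        simp at hu
      have hT1 : ∀ j, j ≤ N → T j = 1 := by
        intro j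
        induction j with
        | zero => intro _; exact hT0
        | succ j ih =>
          intro h
          have h2 := hrec' j (by omega)
          rw [ih (by omega), hν] at h2
          simp only [mul_zero, zero_smul, add_zero, mul_smul_comm, mul_one] at h2
          exact smul_right_injective _ hθ h2
      have : ∀ j ∈ Finset.range N, ω^j • (T j * legA n G - T (j+1) * legB n G)
          = ω^j • (legA n G - legB n G) := by
        intro j hj
        have := Finset.mem_range.mp hj
        rw [hT1 j (by omega), hT1 (j+1) (by omega), one_mul, one_mul]
      rw [Finset.sum_congr rfl this, ← Finset.sum_smul, hprim.geom_sum_eq_zero h1, zero_smul]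
    · have h2 : N = 1 := by omega
      subst h2
      rw [pow_one] at hG
      simp [hT0, hTN, hG, legA, legB]
  have key := key_sum N θ ω ν lam (legA n G) (legB n G) T hT0 hTN hrec' hz hpole
  rw [← legA_k, ← legB_k, ← hk] at key
  have hterm : ∀ c : ℂ, ∀ j ∈ Finset.range N, ω^j • (legB n (K j) * (c • Pmat n) * (legB n (K j))⁻¹)
      = Pmat n * ((ω^j * c) • T j) := by
    intro c j hj
    rw [hTj j (Finset.mem_range.mp hj)]
    simp only [mul_smul_comm, smul_mul_assoc, legB_P, smul_smul, mul_assoc, hW]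
  have hL : ∑ j ∈ Finset.range N, ω^j • (legB n (K j) * ((lam - ω^j*ν)⁻¹ • Pmat n) * (legB n (K j))⁻¹)
      = Pmat n * ∑ j ∈ Finset.range N, (ω^j * (lam - ω^j*ν)⁻¹) • T j := by
    rw [Finset.mul_sum]
    exact Finset.sum_congr rfl fun j hj => hterm _ j hj
  have hR : ∑ j ∈ Finset.range N, ω^j • (legB n (K j) * ((ω * lam - ω^j*ν)⁻¹ • Pmat n) * (legB n (K j))⁻¹)
      = Pmat n * ∑ j ∈ Finset.range N, (ω^j * (ω * lam - ω^j*ν)⁻¹) • T j := by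
    rw [Finset.mul_sum]
    exact Finset.sum_congr rfl fun j hj => hterm _ j hj
  have hshift : ∑ j ∈ Finset.range N, (ω^j * (ω * lam - ω^j*ν)⁻¹) • T j
      = ∑ j ∈ Finset.range N, (ω^j * (lam - ω^j*ν)⁻¹) • T (j+1) := by
    have e1 := Finset.sum_range_succ (fun j => (ω^j * (ω * lam - ω^j*ν)⁻¹) • T j) N
    have e2 := Finset.sum_range_succ' (fun j => (ω^j * (ω * lam - ω^j*ν)⁻¹) • T j) N
    rw [e1] at e2
    simp only [hTN, hT0, hprim.pow_eq_one, pow_zero] at e2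
    rw [add_right_cancel e2]
    refine Finset.sum_congr rfl fun j _ => ?_
    congr 1
    have : ω * lam - ω^(j+1)*ν = ω * (lam - ω^j*ν) := by ring
    rw [this, mul_inv, pow_succ]
    field_simp
  have hc : Commute (∑ j ∈ Finset.range N, (ω^j * (lam - ω^j*ν)⁻¹) • T (j+1)) (legB n (k lam)) := by
    refine Commute.sum_left _ _ _ fun j _ => Commute.smul_left ?_ _
    by_cases h : j + 1 < N
    · rw [hTj _ h]
      exact (legAB n _ _).mul_left (hWk _ h _)
    · simp only [hTdef, h, if_false]
      exact Commute.one_left _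
  change (∑ j ∈ Finset.range N, ω^j • (legB n (K j) * ((lam - ω^j*ν)⁻¹ • Pmat n) * (legB n (K j))⁻¹))
      * legA n (k lam) = legA n (k lam) * ∑ j ∈ Finset.range N,
        ω^j • (legB n (K j) * ((ω * lam - ω^j*ν)⁻¹ • Pmat n) * (legB n (K j))⁻¹)
  rw [hL, hR, hshift, mul_assoc, key, ← mul_assoc (legA n (k lam)), legA_P, mul_assoc, hc.eq]
end
end

section
/- Let a, b, c, d ∈ ℂ satisfy a² + bc + ad + d² = 0, define τ(ν) = (aν + b)/(cν + d), g^{(1)}(ν) = (a + d)²·ν/((aν + b)(cν + d)) and g^{(2)}(ν) = (a + d)²·ν/((dν − b)(−cν + a)). Then the identity 2×2 matrix solves the 3-reflection equation for the trigonometric r-matrix: for all λ, ν at which all expressions are defined, ∑_{j=0}^{2} g^{(j)}(ν)·r(λ, τ^j(ν)) = ∑_{j=0}^{2} g^{(j)}(ν)·r(τ(λ), τ^j(ν)), where g^{(0)} ≡ 1, τ^0(ν) = ν, τ²(ν) = τ(τ(ν)). -/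
open Matrix

noncomputable section

/-- The trigonometric `r`-matrix on `ℂ² ⊗ ℂ²` (basis `e₁⊗e₁, e₁⊗e₂, e₂⊗e₁, e₂⊗e₂`). -/
def rtrig (lam ν : ℂ) : Matrix (Fin 2 × Fin 2) (Fin 2 × Fin 2) ℂ :=
  (2 * (lam - ν))⁻¹ • Matrix.of fun i j =>
    if i = j then (if i.1 = i.2 then -lam - ν else lam + ν)
    else if i = ((0 : Fin 2), (1 : Fin 2)) ∧ j = ((1 : Fin 2), (0 : Fin 2)) then -4 * ν
    else if i = ((1 : Fin 2), (0 : Fin 2)) ∧ j = ((0 : Fin 2), (1 : Fin 2)) then -4 * lam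
    else 0

/-- The Möbius map `τ(ν) = (aν + b)/(cν + d)`. -/
def tauM (a b c d ν : ℂ) : ℂ := (a * ν + b) / (c * ν + d)

/-- `g⁽¹⁾(ν) = (a + d)²·ν/((aν + b)(cν + d))`. -/
def g1M (a b c d ν : ℂ) : ℂ := (a + d) ^ 2 * ν / ((a * ν + b) * (c * ν + d))

/-- `g⁽²⁾(ν) = (a + d)²·ν/((dν - b)(-cν + a))`. -/
def g2M (a b c d ν : ℂ) : ℂ := (a + d) ^ 2 * ν / ((d * ν - b) * (-c * ν + a))

lemma rtrig_eq (x y : ℂ) (h : x ≠ y) (i j : Fin 2 × Fin 2) :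
    rtrig x y i j = rtrig 1 0 i j + (y / (x - y)) * (rtrig 2 1 i j - rtrig 1 0 i j) := by
  have h' : x - y ≠ 0 := sub_ne_zero.mpr h
  simp only [rtrig, Matrix.smul_apply, Matrix.of_apply, smul_eq_mul]
  split_ifs <;> field_simp <;> ring

/-- The identity matrix solves the 3-reflection equation for the trigonometric
`r`-matrix with `τ(ν) = (aν+b)/(cν+d)`, `a² + bc + ad + d² = 0`. -/
theorem stmt13 (a b c d : ℂ) (hconstr : a ^ 2 + b * c + a * d + d ^ 2 = 0)
    (lam ν : ℂ)
    (h1 : lam ≠ ν) (h2 : lam ≠ tauM a b c d ν) (h3 : lam ≠ tauM a b c d (tauM a b c d ν))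
    (h4 : tauM a b c d lam ≠ ν) (h5 : tauM a b c d lam ≠ tauM a b c d ν)
    (h6 : tauM a b c d lam ≠ tauM a b c d (tauM a b c d ν))
    (h7 : c * ν + d ≠ 0) (h8 : c * lam + d ≠ 0) (h9 : c * tauM a b c d ν + d ≠ 0)
    (h10 : a * ν + b ≠ 0) (h11 : d * ν - b ≠ 0) (h12 : -c * ν + a ≠ 0) :
    rtrig lam ν + g1M a b c d ν • rtrig lam (tauM a b c d ν)
        + g2M a b c d ν • rtrig lam (tauM a b c d (tauM a b c d ν))
      = rtrig (tauM a b c d lam) ν + g1M a b c d ν • rtrig (tauM a b c d lam) (tauM a b c d ν)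
        + g2M a b c d ν • rtrig (tauM a b c d lam) (tauM a b c d (tauM a b c d ν)) := by
  have hm : a * d - b * c = (a + d) ^ 2 := by linear_combination -hconstr
  have ht2 : tauM a b c d (tauM a b c d ν) = (d * ν - b) / (-c * ν + a) := by
    have e : c * tauM a b c d ν + d = (c * (a * ν + b) + d * (c * ν + d)) / (c * ν + d) := by
      unfold tauM; field_simp
    have h9' : c * (a * ν + b) + d * (c * ν + d) ≠ 0 := by
      intro h; rw [e, h] at h9; simp at h9
    have e2 : tauM a b c d (tauM a b c d ν)
        = (a * (a * ν + b) + b * (c * ν + d)) / (c * (a * ν + b) + d * (c * ν + d)) := by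
      change (a * tauM a b c d ν + b) / (c * tauM a b c d ν + d) = _
      rw [e, div_eq_div_iff (div_ne_zero h9' h7) h9']
      unfold tauM
      generalize c * ν + d = P at *
      field_simp
    rw [e2, div_eq_div_iff h9' h12]
    linear_combination (-c * ν ^ 2 + a * ν - d * ν + b) * hconstr
  have h0 : lam - ν ≠ 0 := sub_ne_zero.mpr h1
  have hD1 : lam * (c * ν + d) - (a * ν + b) ≠ 0 := by
    intro h; apply h2; unfold tauM; rw [eq_div_iff h7]; linear_combination h
  have hD2 : lam * (-c * ν + a) - (d * ν - b) ≠ 0 := by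
    intro h; apply h3; rw [ht2, eq_div_iff h12]; linear_combination h
  have ht : a + d ≠ 0 := by
    intro h; apply h5; unfold tauM; rw [div_eq_div_iff h8 h7]
    linear_combination (lam - ν) * hm + (lam - ν) * (a + d) * h
  have key : ν / (lam - ν)
        + g1M a b c d ν * (tauM a b c d ν / (lam - tauM a b c d ν))
        + g2M a b c d ν * (tauM a b c d (tauM a b c d ν)
            / (lam - tauM a b c d (tauM a b c d ν)))
      = ν / (tauM a b c d lam - ν)
        + g1M a b c d ν * (tauM a b c d ν / (tauM a b c d lam - tauM a b c d ν))
        + g2M a b c d ν * (tauM a b c d (tauM a b c d ν)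
            / (tauM a b c d lam - tauM a b c d (tauM a b c d ν))) := by
    rw [ht2]
    have s1 : lam - tauM a b c d ν = (lam * (c * ν + d) - (a * ν + b)) / (c * ν + d) := by
      unfold tauM; rw [eq_div_iff h7, sub_mul, div_mul_cancel₀ _ h7]
    have s2 : lam - (d * ν - b) / (-c * ν + a)
        = (lam * (-c * ν + a) - (d * ν - b)) / (-c * ν + a) := by
      rw [eq_div_iff h12, sub_mul, div_mul_cancel₀ _ h12]
    have s3 : tauM a b c d lam - ν
        = (lam * (-c * ν + a) - (d * ν - b)) / (c * lam + d) := by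
      unfold tauM; rw [eq_div_iff h8, sub_mul, div_mul_cancel₀ _ h8]; ring
    have s4 : tauM a b c d lam - tauM a b c d ν
        = (a + d) ^ 2 * (lam - ν) / ((c * lam + d) * (c * ν + d)) := by
      unfold tauM; rw [div_sub_div _ _ h8 h7, ← hm]; congr 1; ring
    have s5 : tauM a b c d lam - (d * ν - b) / (-c * ν + a)
        = -(a + d) * (lam * (c * ν + d) - (a * ν + b)) / ((c * lam + d) * (-c * ν + a)) := by
      unfold tauM; rw [div_sub_div _ _ h8 h12]; congr 1
      linear_combination (lam - ν) * hconstr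
    rw [s1, s2, s3, s4, s5]
    unfold g1M g2M tauM
    generalize hP : c * ν + d = P at *
    generalize hQ : -c * ν + a = Q at *
    generalize hL : c * lam + d = L at *
    generalize hA : a * ν + b = A at *
    generalize hB : d * ν - b = B at *
    generalize hT : a + d = T at *
    generalize hE1 : lam * P - A = E1 at *
    generalize hE2 : lam * Q - B = E2 at *
    generalize hE0 : lam - ν = E0 at *
    have hc0 : L - P = c * E0 := by rw [← hL, ← hP, ← hE0]; ring
    have hc1 : T * Q + L * P = c * E1 := by
      rw [← hE1, ← hT, ← hL, ← hA, ← hP, ← hQ]; linear_combination hconstr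
    have hc2 : T ^ 2 - L * Q = -c * E2 := by
      rw [← hE2, ← hm, ← hL, ← hB, ← hQ]; ring
    have hc3 : T = P + Q := by rw [← hT, ← hP, ← hQ]; ring
    have f1 : 1 / E0 - L / (P * E0) = -c / P := by
      field_simp; linear_combination -hc0
    have f2 : T ^ 2 / (P * E1) + T * L / (Q * E1) = T * c / (P * Q) := by
      field_simp; linear_combination hc1
    have f3 : T ^ 2 / (Q * E2) - L / E2 = -c / Q := by
      field_simp; linear_combination hc2
    have f4 : T * c / (P * Q) = c / P + c / Q := by
      rw [hc3]; field_simp; ring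
    have l1 : ν / E0 + T ^ 2 * ν / (A * P) * (A / P / (E1 / P))
        + T ^ 2 * ν / (B * Q) * (B / Q / (E2 / Q))
        = ν * (1 / E0 + T ^ 2 / (P * E1) + T ^ 2 / (Q * E2)) := by
      field_simp
    have l2 : ν / (E2 / L) + T ^ 2 * ν / (A * P) * (A / P / (T ^ 2 * E0 / (L * P)))
        + T ^ 2 * ν / (B * Q) * (B / Q / (-T * E1 / (L * Q)))
        = ν * (L / E2 + L / (P * E0) - T * L / (Q * E1)) := by
      by_cases hL0 : L = 0
      · exact absurd hL0 h8
      field_simp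
      try ring
    rw [l1, l2]
    linear_combination ν * (f1 + f2 + f3 + f4)
  ext i j
  simp only [Matrix.add_apply, Matrix.smul_apply, smul_eq_mul]
  rw [rtrig_eq _ _ h1, rtrig_eq _ _ h2, rtrig_eq _ _ h3, rtrig_eq _ _ h4, rtrig_eq _ _ h5,
    rtrig_eq _ _ h6]
  linear_combination (rtrig 2 1 i j - rtrig 1 0 i j) * key
end
end
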